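/- Let I be an ideal of a skew brace B such that: (1) the groups (I,+), (I,∘) and (B/I,∘) are finitely generated; (2) the skew braces I and B/I are finitely presented and the group (B/I,+) is finitely presented. Then B is finitely presented as a skew brace. -/

import Mathlib

universe u v

/-- A skew (left) brace: two group structures `(B,+)` and `(B,∘)` on the same set,
sharing the same identity element `zero` (recall that in any skew brace `0 = 1`),
satisfying the skew left distributive law `a ∘ (b + c) = a ∘ b - a + a ∘ c`. -/
structure SkewBrace (B : Type u) where
  add : B → B → B
  zero : B
  neg : B → B
  mul : B → B → B
  inv : B → B
  add_assoc : ∀ a b c, add (add a b) c = add a (add b c)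
  zero_add : ∀ a, add zero a = a
  add_zero : ∀ a, add a zero = a
  neg_add : ∀ a, add (neg a) a = zero
  add_neg : ∀ a, add a (neg a) = zero
  mul_assoc : ∀ a b c, mul (mul a b) c = mul a (mul b c)
  zero_mul : ∀ a, mul zero a = a
  mul_zero : ∀ a, mul a zero = a
  inv_mul : ∀ a, mul (inv a) a = zero
  mul_inv : ∀ a, mul a (inv a) = zero
  compat : ∀ a b c, mul a (add b c) = add (add (mul a b) (neg a)) (mul a c)

namespace SkewBrace

variable {B C Q : Type u}

/-- `λ_a (b) = -a + a ∘ b`. -/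
def lam (S : SkewBrace B) (a b : B) : B := S.add (S.neg a) (S.mul a b)

/-- `a ∗ b = λ_a(b) - b = -a + a ∘ b - b`. -/
def star (S : SkewBrace B) (a b : B) : B := S.add (S.lam a b) (S.neg b)

/-- A sub-skew brace: a subset containing the identity and closed under both group
operations and both inverses. -/
def IsSub (S : SkewBrace B) (T : Set B) : Prop :=
  S.zero ∈ T ∧ (∀ a ∈ T, ∀ b ∈ T, S.add a b ∈ T) ∧ (∀ a ∈ T, S.neg a ∈ T) ∧
    (∀ a ∈ T, ∀ b ∈ T, S.mul a b ∈ T) ∧ (∀ a ∈ T, S.inv a ∈ T)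

/-- The sub-skew brace generated by a subset. -/
def subGen (S : SkewBrace B) (X : Set B) : Set B := ⋂₀ {T | S.IsSub T ∧ X ⊆ T}

/-- A skew brace is finitely generated if a finite subset generates it. -/
def FinitelyGenerated (S : SkewBrace B) : Prop := ∃ T : Finset B, S.subGen ↑T = Set.univ

/-- A subgroup of the additive group `(B,+)`. -/
def IsAddSubgroup (S : SkewBrace B) (T : Set B) : Prop :=
  S.zero ∈ T ∧ (∀ a ∈ T, ∀ b ∈ T, S.add a b ∈ T) ∧ ∀ a ∈ T, S.neg a ∈ T

/-- A subgroup of the multiplicative group `(B,∘)`. -/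
def IsMulSubgroup (S : SkewBrace B) (T : Set B) : Prop :=
  S.zero ∈ T ∧ (∀ a ∈ T, ∀ b ∈ T, S.mul a b ∈ T) ∧ ∀ a ∈ T, S.inv a ∈ T

/-- The additive subgroup generated by a subset. -/
def addClosure (S : SkewBrace B) (X : Set B) : Set B := ⋂₀ {T | S.IsAddSubgroup T ∧ X ⊆ T}

/-- The multiplicative subgroup generated by a subset. -/
def mulClosure (S : SkewBrace B) (X : Set B) : Set B := ⋂₀ {T | S.IsMulSubgroup T ∧ X ⊆ T}

/-- The group `(B,+)` is finitely generated. -/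
def AddFG (S : SkewBrace B) : Prop := ∃ T : Finset B, S.addClosure ↑T = Set.univ

/-- The group `(B,∘)` is finitely generated. -/
def MulFG (S : SkewBrace B) : Prop := ∃ T : Finset B, S.mulClosure ↑T = Set.univ

/-- An ideal of a skew brace: a subgroup of `(B,+)`, normal in `(B,+)` and in `(B,∘)`,
invariant under all the maps `λ_b`. -/
def IsIdeal (S : SkewBrace B) (I : Set B) : Prop :=
  S.IsAddSubgroup I ∧ (∀ b : B, ∀ a ∈ I, S.add (S.add b a) (S.neg b) ∈ I) ∧
    (∀ b : B, ∀ a ∈ I, S.mul (S.mul b a) (S.inv b) ∈ I) ∧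
    ∀ b : B, ∀ a ∈ I, S.lam b a ∈ I

/-- The ideal generated by a subset (the smallest ideal containing it). -/
def idealGen (S : SkewBrace B) (X : Set B) : Set B := ⋂₀ {I | S.IsIdeal I ∧ X ⊆ I}

/-- A homomorphism of skew braces. -/
def IsHom (S : SkewBrace B) (T : SkewBrace C) (f : B → C) : Prop :=
  (∀ a b, f (S.add a b) = T.add (f a) (f b)) ∧ ∀ a b, f (S.mul a b) = T.mul (f a) (f b)

/-- `SF` together with `ι : X → F` is the free skew brace on `X`: every map from `X`
to a skew brace extends uniquely to a homomorphism. -/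
def IsFreeOn {F : Type u} {X : Type v} (SF : SkewBrace F) (ι : X → F) : Prop :=
  ∀ (C : Type u) (SC : SkewBrace C) (f : X → C),
    ∃! g : F → C, IsHom SF SC g ∧ ∀ x, g (ι x) = f x

/-- A skew brace is finitely presented if it is the image of a free skew brace on a
finite set under a homomorphism whose kernel is generated, as an ideal, by finitely
many elements. -/
def FinitelyPresented (S : SkewBrace B) : Prop :=
  ∃ (F : Type u) (SF : SkewBrace F) (m : ℕ) (ι : Fin m → F) (θ : F → B),
    IsFreeOn SF ι ∧ IsHom SF S θ ∧ Function.Surjective θ ∧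
      ∃ R : Finset F, {x | θ x = S.zero} = SF.idealGen ↑R

/-- `π : B → Q` realizes `Q` as the quotient skew brace `B/I`. -/
def IsQuotientBy (S : SkewBrace B) (I : Set B) (SQ : SkewBrace Q) (π : B → Q) : Prop :=
  IsHom S SQ π ∧ Function.Surjective π ∧ {x | π x = SQ.zero} = I

/-- The group `(B,+)` is finitely presented (as an abstract group). -/
def AddFP (S : SkewBrace B) : Prop :=
  ∃ (m : ℕ) (f : FreeGroup (Fin m) → B),
    (∀ x y, f (x * y) = S.add (f x) (f y)) ∧ Function.Surjective f ∧
      ∃ R : Finset (FreeGroup (Fin m)),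
        {x | f x = S.zero} = ↑(Subgroup.normalClosure (R : Set (FreeGroup (Fin m))))

/-- The group `(B,∘)` is finitely presented (as an abstract group). -/
def MulFP (S : SkewBrace B) : Prop :=
  ∃ (m : ℕ) (f : FreeGroup (Fin m) → B),
    (∀ x y, f (x * y) = S.mul (f x) (f y)) ∧ Function.Surjective f ∧
      ∃ R : Finset (FreeGroup (Fin m)),
        {x | f x = S.zero} = ↑(Subgroup.normalClosure (R : Set (FreeGroup (Fin m))))

/-- The ascending chain condition on sub-skew braces. -/
def SubACC (S : SkewBrace B) : Prop :=
  ∀ f : ℕ → Set B, Monotone f → (∀ n, S.IsSub (f n)) → ∃ n, ∀ m, n ≤ m → f m = f n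

/-- The ascending chain condition on subgroups of `(B,+)`. -/
def AddACC (S : SkewBrace B) : Prop :=
  ∀ f : ℕ → Set B, Monotone f → (∀ n, S.IsAddSubgroup (f n)) → ∃ n, ∀ m, n ≤ m → f m = f n

/-- The socle `Soc(B) = Ker(λ) ∩ Z(B,+)`. -/
def soc (S : SkewBrace B) : Set B :=
  {x | (∀ b, S.lam x b = b) ∧ ∀ b, S.add x b = S.add b x}

/-- The centre of the additive group `(B,+)`. -/
def addCenter (S : SkewBrace B) : Set B := {x | ∀ b, S.add x b = S.add b x}

/-- The preimage in `B` of `Ann(B/I)` (for `I` an ideal): the set of `x` such that,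
modulo `I`, `λ_x = id`, `x` is central in `(B,+)` and `x` is central in `(B,∘)`. -/
def annStep (S : SkewBrace B) (I : Set B) : Set B :=
  {x | (∀ b, S.add (S.lam x b) (S.neg b) ∈ I) ∧
       (∀ b, S.add (S.add x b) (S.neg (S.add b x)) ∈ I) ∧
       ∀ b, S.mul (S.mul x b) (S.inv (S.mul b x)) ∈ I}

/-- The preimage in `B` of `Soc(B/I)` (for `I` an ideal). -/
def socStep (S : SkewBrace B) (I : Set B) : Set B :=
  {x | (∀ b, S.add (S.lam x b) (S.neg b) ∈ I) ∧
       ∀ b, S.add (S.add x b) (S.neg (S.add b x)) ∈ I}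

/-- The upper annihilator series `Ann_α(B)`, defined by transfinite recursion. -/
noncomputable def annSeries (S : SkewBrace B) (o : Ordinal.{v}) : Set B :=
  Ordinal.limitRecOn o {S.zero} (fun _ ih => S.annStep ih)
    fun _o _ ih => ⋃ β, ⋃ h : β < _o, ih β h

/-- The upper socle series `Soc_α(B)`, defined by transfinite recursion. -/
noncomputable def socSeries (S : SkewBrace B) (o : Ordinal.{v}) : Set B :=
  Ordinal.limitRecOn o {S.zero} (fun _ ih => S.socStep ih)
    fun _o _ ih => ⋃ β, ⋃ h : β < _o, ih β h

/-- The solution of the YBE associated with a skew brace: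
`r_B(a,b) = (λ_a(b), λ_a(b)⁻¹ ∘ a ∘ b)`. -/
def braceR (S : SkewBrace B) : B × B → B × B :=
  fun p => (S.lam p.1 p.2, S.mul (S.inv (S.lam p.1 p.2)) (S.mul p.1 p.2))

end SkewBrace

/-- The set-theoretic Yang–Baxter (braid) equation
`(r × id)(id × r)(r × id) = (id × r)(r × id)(id × r)`. -/
def ybe {X : Type u} (r : X × X → X × X) : Prop :=
  let r₁ : X × X × X → X × X × X := fun p =>
    ((r (p.1, p.2.1)).1, (r (p.1, p.2.1)).2, p.2.2)
  let r₂ : X × X × X → X × X × X := fun p => (p.1, r p.2)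
  r₁ ∘ r₂ ∘ r₁ = r₂ ∘ r₁ ∘ r₂

/-- A non-degenerate set-theoretic solution: `r` is bijective, satisfies the YBE, and
writing `r (x,y) = (σ_x y, τ_y x)`, all maps `σ_x` and `τ_y` are bijective. -/
def IsNonDegenerateSolution {X : Type u} (r : X × X → X × X) : Prop :=
  Function.Bijective r ∧ ybe r ∧
    (∀ x, Function.Bijective fun y => (r (x, y)).1) ∧
    ∀ y, Function.Bijective fun x => (r (x, y)).2

/-- `S` (with the distinguished map `ι : X → B`) is the structure skew brace of the
solution `(X,r)`: the multiplicative group of `S` is the structure group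
`G(X,r) = ⟨X | x y = σ_x(y) τ_y(x)⟩` (expressed by the relations holding together
with the universal property of the presentation) and `r_S ∘ (ι × ι) = (ι × ι) ∘ r`. -/
def IsStructureSkewBrace {X B : Type u} (r : X × X → X × X)
    (S : SkewBrace B) (ι : X → B) : Prop :=
  (∀ x y, S.mul (ι x) (ι y) = S.mul (ι (r (x, y)).1) (ι (r (x, y)).2)) ∧
  (∀ (H : Type u) [Group H] (f : X → H),
      (∀ x y, f x * f y = f (r (x, y)).1 * f (r (x, y)).2) →
      ∃! φ : B → H, (∀ a b, φ (S.mul a b) = φ a * φ b) ∧ ∀ x, φ (ι x) = f x) ∧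
  ∀ x y, S.braceR (ι x, ι y) = (ι (r (x, y)).1, ι (r (x, y)).2)

namespace SkewBrace

section Basic

variable {B C : Type u} (S : SkewBrace B)

theorem neg_add_cancel_left (a b : B) : S.add (S.neg a) (S.add a b) = b := by
  rw [← S.add_assoc, S.neg_add, S.zero_add]

theorem add_neg_cancel_left (a b : B) : S.add a (S.add (S.neg a) b) = b := by
  rw [← S.add_assoc, S.add_neg, S.zero_add]

theorem inv_mul_cancel_left (a b : B) : S.mul (S.inv a) (S.mul a b) = b := by
  rw [← S.mul_assoc, S.inv_mul, S.zero_mul]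

theorem mul_inv_cancel_left (a b : B) : S.mul a (S.mul (S.inv a) b) = b := by
  rw [← S.mul_assoc, S.mul_inv, S.zero_mul]

theorem neg_eq_of_add_eq_zero {a b : B} (h : S.add a b = S.zero) : S.neg a = b := by
  rw [← S.neg_add_cancel_left a b, h, S.add_zero]

theorem inv_eq_of_mul_eq_zero {a b : B} (h : S.mul a b = S.zero) : S.inv a = b := by
  rw [← S.inv_mul_cancel_left a b, h, S.mul_zero]

theorem neg_neg (a : B) : S.neg (S.neg a) = a :=
  S.neg_eq_of_add_eq_zero (S.neg_add a)

theorem inv_inv (a : B) : S.inv (S.inv a) = a :=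
  S.inv_eq_of_mul_eq_zero (S.inv_mul a)

theorem neg_zero : S.neg S.zero = S.zero :=
  S.neg_eq_of_add_eq_zero (S.zero_add _)

theorem neg_add_rev (a b : B) : S.neg (S.add a b) = S.add (S.neg b) (S.neg a) := by
  apply S.neg_eq_of_add_eq_zero
  rw [S.add_assoc, S.add_neg_cancel_left, S.add_neg]

theorem inv_mul_rev (a b : B) : S.inv (S.mul a b) = S.mul (S.inv b) (S.inv a) := by
  apply S.inv_eq_of_mul_eq_zero
  rw [S.mul_assoc, S.mul_inv_cancel_left, S.mul_inv]

theorem eq_of_neg_add_eq_zero {a b : B} (h : S.add (S.neg a) b = S.zero) : a = b := by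
  rw [← S.neg_eq_of_add_eq_zero h, S.neg_neg]

theorem eq_of_add_neg_eq_zero {a b : B} (h : S.add a (S.neg b) = S.zero) : a = b := by
  rw [← S.neg_neg a, S.neg_eq_of_add_eq_zero h, S.neg_neg]

theorem mul_eq_add_lam (a b : B) : S.mul a b = S.add a (S.lam a b) := by
  rw [lam, S.add_neg_cancel_left]

theorem lam_add (a b c : B) : S.lam a (S.add b c) = S.add (S.lam a b) (S.lam a c) := by
  simp only [lam, S.compat, S.add_assoc]

theorem lam_zero (a : B) : S.lam a S.zero = S.zero := by
  rw [lam, S.mul_zero, S.neg_add]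

theorem lam_neg (a b : B) : S.lam a (S.neg b) = S.neg (S.lam a b) := by
  symm
  apply S.neg_eq_of_add_eq_zero
  rw [← S.lam_add, S.add_neg, S.lam_zero]

theorem zero_lam (b : B) : S.lam S.zero b = b := by
  rw [lam, S.zero_mul, S.neg_zero, S.zero_add]

theorem mul_lam (a b c : B) : S.lam (S.mul a b) c = S.lam a (S.lam b c) := by
  have h : S.mul (S.mul a b) c = S.mul a (S.mul b c) := S.mul_assoc a b c
  rw [S.mul_eq_add_lam b c, S.compat, S.mul_eq_add_lam a (S.lam b c), S.add_assoc,
    S.neg_add_cancel_left] at h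
  rw [lam, h, S.neg_add_cancel_left]

theorem inv_eq_neg_lam (a : B) : S.inv a = S.neg (S.lam (S.inv a) a) := by
  rw [← S.neg_neg (S.inv a)]
  congr 1
  apply S.neg_eq_of_add_eq_zero
  rw [S.neg_neg, ← S.mul_eq_add_lam, S.inv_mul]

theorem isAddSubgroup_addClosure (X : Set B) : S.IsAddSubgroup (S.addClosure X) := by
  refine ⟨fun T hT => hT.1.1, fun a ha b hb T hT => ?_, fun a ha T hT => ?_⟩
  · exact hT.1.2.1 a (ha T hT) b (hb T hT)
  · exact hT.1.2.2 a (ha T hT)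

theorem addClosure_subset {X T : Set B} (hT : S.IsAddSubgroup T) (h : X ⊆ T) :
    S.addClosure X ⊆ T := fun _ hx => hx T ⟨hT, h⟩

theorem mulClosure_subset {X T : Set B} (hT : S.IsMulSubgroup T) (h : X ⊆ T) :
    S.mulClosure X ⊆ T := fun _ hx => hx T ⟨hT, h⟩

theorem subset_addClosure (X : Set B) : X ⊆ S.addClosure X := fun _ hx _ hT => hT.2 hx

theorem subset_idealGen (X : Set B) : X ⊆ S.idealGen X := fun _ hx _ hT => hT.2 hx

theorem idealGen_subset {X T : Set B} (hT : S.IsIdeal T) (h : X ⊆ T) :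
    S.idealGen X ⊆ T := fun _ hx => hx T ⟨hT, h⟩

theorem isIdeal_idealGen (X : Set B) : S.IsIdeal (S.idealGen X) := by
  refine ⟨⟨fun T hT => hT.1.1.1, fun a ha b hb T hT => ?_, fun a ha T hT => ?_⟩,
    fun b a ha T hT => ?_, fun b a ha T hT => ?_, fun b a ha T hT => ?_⟩
  · exact hT.1.1.2.1 a (ha T hT) b (hb T hT)
  · exact hT.1.1.2.2 a (ha T hT)
  · exact hT.1.2.1 b a (ha T hT)
  · exact hT.1.2.2.1 b a (ha T hT)
  · exact hT.1.2.2.2 b a (ha T hT)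

end Basic

namespace IsHom

variable {B C D : Type u} {S : SkewBrace B} {T : SkewBrace C} {U : SkewBrace D} {f : B → C}

theorem map_zero (hf : IsHom S T f) : f S.zero = T.zero := by
  have h := hf.1 S.zero S.zero
  rw [S.zero_add] at h
  rw [← T.neg_add (f S.zero)]
  nth_rewrite 3 [h]
  rw [T.neg_add_cancel_left]

theorem map_neg (hf : IsHom S T f) (a : B) : f (S.neg a) = T.neg (f a) := by
  symm
  apply T.neg_eq_of_add_eq_zero
  rw [← hf.1, S.add_neg, hf.map_zero]

theorem map_inv (hf : IsHom S T f) (a : B) : f (S.inv a) = T.inv (f a) := by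
  symm
  apply T.inv_eq_of_mul_eq_zero
  rw [← hf.2, S.mul_inv, hf.map_zero]

theorem map_lam (hf : IsHom S T f) (a b : B) : f (S.lam a b) = T.lam (f a) (f b) := by
  rw [lam, lam, hf.1, hf.map_neg, hf.2]

theorem comp {g : C → D} (hg : IsHom T U g) (hf : IsHom S T f) : IsHom S U (g ∘ f) :=
  ⟨fun a b => by simp only [Function.comp, hf.1, hg.1],
    fun a b => by simp only [Function.comp, hf.2, hg.2]⟩

theorem isIdeal_ker (hf : IsHom S T f) : S.IsIdeal {x | f x = T.zero} := by
  refine ⟨⟨hf.map_zero, fun a ha b hb => ?_, fun a ha => ?_⟩,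
    fun b a ha => ?_, fun b a ha => ?_, fun b a ha => ?_⟩ <;>
    simp only [Set.mem_ofPred_eq] at *
  · rw [hf.1, ha, hb, T.zero_add]
  · rw [hf.map_neg, ha, T.neg_zero]
  · rw [hf.1, hf.1, ha, hf.map_neg, T.add_zero, T.add_neg]
  · rw [hf.2, hf.2, ha, hf.map_inv, T.mul_zero, T.mul_inv]
  · rw [hf.map_lam, ha, T.lam_zero]

theorem eq_of_ker_trivial (hf : IsHom S T f) {N : Set B} (hN : S.IsAddSubgroup N)
    (hker : ∀ n ∈ N, f n = T.zero → n = S.zero) {a b : B} (ha : a ∈ N) (hb : b ∈ N)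
    (h : f a = f b) : a = b := by
  apply S.eq_of_neg_add_eq_zero
  apply hker _ (hN.2.1 _ (hN.2.2 _ ha) _ hb)
  rw [hf.1, hf.map_neg, h, T.neg_add]

theorem isAddSubgroup_image (hf : IsHom S T f) {N : Set B} (hN : S.IsAddSubgroup N) :
    T.IsAddSubgroup (f '' N) := by
  refine ⟨⟨_, hN.1, hf.map_zero⟩, ?_, ?_⟩
  · rintro _ ⟨a, ha, rfl⟩ _ ⟨b, hb, rfl⟩
    exact ⟨_, hN.2.1 a ha b hb, hf.1 a b⟩
  · rintro _ ⟨a, ha, rfl⟩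
    exact ⟨_, hN.2.2 a ha, hf.map_neg a⟩

theorem isMulSubgroup_image (hf : IsHom S T f) {N : Set B} (hN : S.IsMulSubgroup N) :
    T.IsMulSubgroup (f '' N) := by
  refine ⟨⟨_, hN.1, hf.map_zero⟩, ?_, ?_⟩
  · rintro _ ⟨a, ha, rfl⟩ _ ⟨b, hb, rfl⟩
    exact ⟨_, hN.2.1 a ha b hb, hf.2 a b⟩
  · rintro _ ⟨a, ha, rfl⟩
    exact ⟨_, hN.2.2 a ha, hf.map_inv a⟩

theorem isSub_preimage (hf : IsHom S T f) {M : Set C} (hM : T.IsSub M) : S.IsSub (f ⁻¹' M) := by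
  refine ⟨?_, fun a ha b hb => ?_, fun a ha => ?_, fun a ha b hb => ?_, fun a ha => ?_⟩ <;>
    rw [Set.mem_preimage]
  · rw [hf.map_zero]
    exact hM.1
  · rw [hf.1]
    exact hM.2.1 _ ha _ hb
  · rw [hf.map_neg]
    exact hM.2.2.1 _ ha
  · rw [hf.2]
    exact hM.2.2.2.1 _ ha _ hb
  · rw [hf.map_inv]
    exact hM.2.2.2.2 _ ha

end IsHom

section Quotient

variable {B C : Type u} (S : SkewBrace B) {I : Set B}

theorem IsIdeal.neg_conj_mem {S : SkewBrace B} (hI : S.IsIdeal I) (b : B) {a : B} (ha : a ∈ I) :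
    S.add (S.neg b) (S.add a b) ∈ I := by
  have h := hI.2.1 (S.neg b) a ha
  rwa [S.neg_neg, S.add_assoc] at h

theorem IsIdeal.inv_conj_mem {S : SkewBrace B} (hI : S.IsIdeal I) (b : B) {a : B} (ha : a ∈ I) :
    S.mul (S.inv b) (S.mul a b) ∈ I := by
  have h := hI.2.2.1 (S.inv b) a ha
  rwa [S.inv_inv, S.mul_assoc] at h

theorem IsIdeal.mul_mem {S : SkewBrace B} (hI : S.IsIdeal I) {a b : B} (ha : a ∈ I) (hb : b ∈ I) :
    S.mul a b ∈ I := by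
  rw [S.mul_eq_add_lam]
  exact hI.1.2.1 _ ha _ (hI.2.2.2 _ _ hb)

theorem IsIdeal.inv_mem {S : SkewBrace B} (hI : S.IsIdeal I) {a : B} (ha : a ∈ I) :
    S.inv a ∈ I := by
  rw [S.inv_eq_neg_lam]
  exact hI.1.2.2 _ (hI.2.2.2 _ _ ha)

/-- Congruence modulo an ideal. -/
def idealSetoid (hI : S.IsIdeal I) : Setoid B where
  r a b := S.add (S.neg a) b ∈ I
  iseqv :=
    { refl := fun a => by
        rw [S.neg_add]
        exact hI.1.1
      symm := fun {a b} h => by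
        have h' := hI.1.2.2 _ h
        rwa [S.neg_add_rev, S.neg_neg] at h'
      trans := fun {a b c} h h' => by
        have h'' := hI.1.2.1 _ h _ h'
        rwa [S.add_assoc, S.add_neg_cancel_left] at h'' }

theorem idealSetoid_add (hI : S.IsIdeal I) {a b c d : B} (h : S.idealSetoid hI a b)
    (h' : S.idealSetoid hI c d) : S.idealSetoid hI (S.add a c) (S.add b d) := by
  change S.add (S.neg (S.add a c)) (S.add b d) ∈ I
  have h₁ := hI.1.2.1 _ (hI.neg_conj_mem c h) _ h'
  simpa only [S.neg_add_rev, S.add_assoc, S.add_neg_cancel_left] using h₁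

theorem idealSetoid_neg (hI : S.IsIdeal I) {a b : B} (h : S.idealSetoid hI a b) :
    S.idealSetoid hI (S.neg a) (S.neg b) := by
  change S.add (S.neg (S.neg a)) (S.neg b) ∈ I
  have h₁ := hI.2.1 b _ ((S.idealSetoid hI).symm h)
  rw [S.add_neg_cancel_left] at h₁
  rwa [S.neg_neg]

theorem idealSetoid_iff_mul (hI : S.IsIdeal I) {a b : B} :
    S.idealSetoid hI a b ↔ S.mul (S.inv a) b ∈ I := by
  have key : S.add (S.neg a) b = S.lam a (S.mul (S.inv a) b) := by
    rw [lam, S.mul_inv_cancel_left]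
  change S.add (S.neg a) b ∈ I ↔ _
  rw [key]
  refine ⟨fun h => ?_, hI.2.2.2 _ _⟩
  have h' := hI.2.2.2 (S.inv a) _ h
  rwa [← S.mul_lam, S.inv_mul, S.zero_lam] at h'

theorem idealSetoid_mul (hI : S.IsIdeal I) {a b c d : B} (h : S.idealSetoid hI a b)
    (h' : S.idealSetoid hI c d) : S.idealSetoid hI (S.mul a c) (S.mul b d) := by
  rw [idealSetoid_iff_mul] at *
  have h₁ := hI.mul_mem (hI.inv_conj_mem c h) h'
  simpa only [S.inv_mul_rev, S.mul_assoc, S.mul_inv_cancel_left] using h₁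

theorem idealSetoid_inv (hI : S.IsIdeal I) {a b : B} (h : S.idealSetoid hI a b) :
    S.idealSetoid hI (S.inv a) (S.inv b) := by
  have h₀ := (S.idealSetoid hI).symm h
  have h₁ := hI.2.2.1 b _ ((S.idealSetoid_iff_mul hI).mp h₀)
  rw [S.mul_inv_cancel_left] at h₁
  rwa [idealSetoid_iff_mul, S.inv_inv]

/-- The quotient of a skew brace by an ideal. -/
def quotient (hI : S.IsIdeal I) : SkewBrace (Quotient (S.idealSetoid hI)) where
  add := Quotient.map₂ S.add fun _ _ h _ _ h' => S.idealSetoid_add hI h h'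
  zero := Quotient.mk _ S.zero
  neg := Quotient.map S.neg fun _ _ h => S.idealSetoid_neg hI h
  mul := Quotient.map₂ S.mul fun _ _ h _ _ h' => S.idealSetoid_mul hI h h'
  inv := Quotient.map S.inv fun _ _ h => S.idealSetoid_inv hI h
  add_assoc := by rintro ⟨a⟩ ⟨b⟩ ⟨c⟩; exact congrArg (Quotient.mk _) (S.add_assoc a b c)
  zero_add := by rintro ⟨a⟩; exact congrArg (Quotient.mk _) (S.zero_add a)
  add_zero := by rintro ⟨a⟩; exact congrArg (Quotient.mk _) (S.add_zero a)
  neg_add := by rintro ⟨a⟩; exact congrArg (Quotient.mk _) (S.neg_add a)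
  add_neg := by rintro ⟨a⟩; exact congrArg (Quotient.mk _) (S.add_neg a)
  mul_assoc := by rintro ⟨a⟩ ⟨b⟩ ⟨c⟩; exact congrArg (Quotient.mk _) (S.mul_assoc a b c)
  zero_mul := by rintro ⟨a⟩; exact congrArg (Quotient.mk _) (S.zero_mul a)
  mul_zero := by rintro ⟨a⟩; exact congrArg (Quotient.mk _) (S.mul_zero a)
  inv_mul := by rintro ⟨a⟩; exact congrArg (Quotient.mk _) (S.inv_mul a)
  mul_inv := by rintro ⟨a⟩; exact congrArg (Quotient.mk _) (S.mul_inv a)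
  compat := by rintro ⟨a⟩ ⟨b⟩ ⟨c⟩; exact congrArg (Quotient.mk _) (S.compat a b c)

theorem isQuotientBy_quotient (hI : S.IsIdeal I) :
    S.IsQuotientBy I (S.quotient hI) (Quotient.mk _) := by
  refine ⟨⟨fun _ _ => rfl, fun _ _ => rfl⟩, Quotient.mk_surjective, ?_⟩
  ext x
  change Quotient.mk _ x = Quotient.mk _ S.zero ↔ _
  rw [eq_comm, Quotient.eq]
  change S.add (S.neg S.zero) x ∈ I ↔ _
  rw [S.neg_zero, S.zero_add]

/-- A homomorphism vanishing on an ideal factors through the quotient. -/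
theorem exists_quotient_lift (hI : S.IsIdeal I) {T : SkewBrace C} {f : B → C}
    (hf : IsHom S T f) (hfI : ∀ x ∈ I, f x = T.zero) :
    ∃ g : Quotient (S.idealSetoid hI) → C, IsHom (S.quotient hI) T g ∧
      ∀ x, g (Quotient.mk _ x) = f x := by
  refine ⟨Quotient.lift f fun a b h => ?_, ⟨?_, ?_⟩, fun _ => rfl⟩
  · apply T.eq_of_neg_add_eq_zero
    rw [← hf.map_neg, ← hf.1]
    exact hfI _ h
  · rintro ⟨a⟩ ⟨b⟩
    exact hf.1 a b
  · rintro ⟨a⟩ ⟨b⟩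
    exact hf.2 a b

/-- An ideal, as a skew brace. -/
def restrict (hI : S.IsIdeal I) : SkewBrace I where
  add a b := ⟨S.add a b, hI.1.2.1 _ a.2 _ b.2⟩
  zero := ⟨S.zero, hI.1.1⟩
  neg a := ⟨S.neg a, hI.1.2.2 _ a.2⟩
  mul a b := ⟨S.mul a b, hI.mul_mem a.2 b.2⟩
  inv a := ⟨S.inv a, hI.inv_mem a.2⟩
  add_assoc _ _ _ := Subtype.ext (S.add_assoc _ _ _)
  zero_add _ := Subtype.ext (S.zero_add _)
  add_zero _ := Subtype.ext (S.add_zero _)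
  neg_add _ := Subtype.ext (S.neg_add _)
  add_neg _ := Subtype.ext (S.add_neg _)
  mul_assoc _ _ _ := Subtype.ext (S.mul_assoc _ _ _)
  zero_mul _ := Subtype.ext (S.zero_mul _)
  mul_zero _ := Subtype.ext (S.mul_zero _)
  inv_mul _ := Subtype.ext (S.inv_mul _)
  mul_inv _ := Subtype.ext (S.mul_inv _)
  compat _ _ _ := Subtype.ext (S.compat _ _ _)

end Quotient

section Free

/-- Formal skew brace expressions in the variables `X`. -/
inductive BraceTerm (X : Type) : Type u
  | of (x : X) : BraceTerm X
  | zero : BraceTerm X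
  | add (a b : BraceTerm X) : BraceTerm X
  | neg (a : BraceTerm X) : BraceTerm X
  | mul (a b : BraceTerm X) : BraceTerm X
  | inv (a : BraceTerm X) : BraceTerm X

/-- Evaluation of an expression in a skew brace. -/
def BraceTerm.eval {X : Type} {C : Type u} (S : SkewBrace C) (f : X → C) : BraceTerm.{u} X → C
  | of x => f x
  | zero => S.zero
  | add a b => S.add (a.eval S f) (b.eval S f)
  | neg a => S.neg (a.eval S f)
  | mul a b => S.mul (a.eval S f) (b.eval S f)
  | inv a => S.inv (a.eval S f)

/-- Two expressions are identified if they agree under every evaluation in a skew brace. -/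
def braceTermSetoid (X : Type) : Setoid (BraceTerm.{u} X) where
  r a b := ∀ (C : Type u) (S : SkewBrace C) (f : X → C), a.eval S f = b.eval S f
  iseqv :=
    { refl := fun _ _ _ _ => rfl
      symm := fun h C S f => (h C S f).symm
      trans := fun h h' C S f => (h C S f).trans (h' C S f) }

/-- The underlying type of the free skew brace on `X`. -/
abbrev Free (X : Type) : Type u := Quotient (braceTermSetoid.{u} X)

/-- The free skew brace on `X`. -/
def free (X : Type) : SkewBrace (Free.{u} X) where
  add := Quotient.map₂ BraceTerm.add fun _ _ h _ _ h' C S f => by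
    simp only [BraceTerm.eval, h C S f, h' C S f]
  zero := Quotient.mk _ BraceTerm.zero
  neg := Quotient.map BraceTerm.neg fun _ _ h C S f => by simp only [BraceTerm.eval, h C S f]
  mul := Quotient.map₂ BraceTerm.mul fun _ _ h _ _ h' C S f => by
    simp only [BraceTerm.eval, h C S f, h' C S f]
  inv := Quotient.map BraceTerm.inv fun _ _ h C S f => by simp only [BraceTerm.eval, h C S f]
  add_assoc := by rintro ⟨a⟩ ⟨b⟩ ⟨c⟩; exact Quotient.sound fun _ S _ => S.add_assoc _ _ _
  zero_add := by rintro ⟨a⟩; exact Quotient.sound fun _ S _ => S.zero_add _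
  add_zero := by rintro ⟨a⟩; exact Quotient.sound fun _ S _ => S.add_zero _
  neg_add := by rintro ⟨a⟩; exact Quotient.sound fun _ S _ => S.neg_add _
  add_neg := by rintro ⟨a⟩; exact Quotient.sound fun _ S _ => S.add_neg _
  mul_assoc := by rintro ⟨a⟩ ⟨b⟩ ⟨c⟩; exact Quotient.sound fun _ S _ => S.mul_assoc _ _ _
  zero_mul := by rintro ⟨a⟩; exact Quotient.sound fun _ S _ => S.zero_mul _
  mul_zero := by rintro ⟨a⟩; exact Quotient.sound fun _ S _ => S.mul_zero _
  inv_mul := by rintro ⟨a⟩; exact Quotient.sound fun _ S _ => S.inv_mul _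
  mul_inv := by rintro ⟨a⟩; exact Quotient.sound fun _ S _ => S.mul_inv _
  compat := by rintro ⟨a⟩ ⟨b⟩ ⟨c⟩; exact Quotient.sound fun _ S _ => S.compat _ _ _

/-- The canonical map from `X` to the free skew brace on `X`. -/
def freeOf {X : Type} (x : X) : Free.{u} X := Quotient.mk _ (BraceTerm.of x)

theorem free_induction {X : Type} {N : Set (Free.{u} X)} (hN : (free X).IsSub N)
    (h : ∀ x, freeOf x ∈ N) (a : Free.{u} X) : a ∈ N := by
  obtain ⟨a⟩ := a
  induction a with
  | of x => exact h x
  | zero => exact hN.1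
  | add a b ha hb => exact hN.2.1 _ ha _ hb
  | neg a ha => exact hN.2.2.1 _ ha
  | mul a b ha hb => exact hN.2.2.2.1 _ ha _ hb
  | inv a ha => exact hN.2.2.2.2 _ ha

theorem isFreeOn_free (X : Type) : IsFreeOn (free.{u} X) freeOf := by
  intro C S f
  refine ⟨Quotient.lift (BraceTerm.eval S f) fun a b h => h C S f, ⟨⟨?_, ?_⟩, fun _ => rfl⟩, ?_⟩
  · rintro ⟨a⟩ ⟨b⟩
    rfl
  · rintro ⟨a⟩ ⟨b⟩
    rfl
  · rintro g ⟨hg, hgf⟩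
    funext a
    obtain ⟨a⟩ := a
    induction a with
    | of x => exact hgf x
    | zero => exact hg.map_zero
    | add a b ha hb => exact (hg.1 _ _).trans (congrArg₂ S.add ha hb)
    | neg a ha => exact (hg.map_neg _).trans (congrArg S.neg ha)
    | mul a b ha hb => exact (hg.2 _ _).trans (congrArg₂ S.mul ha hb)
    | inv a ha => exact (hg.map_inv _).trans (congrArg S.inv ha)

end Free

section AddGroup

variable {B : Type u} (S : SkewBrace B)

/-- The additive group of a skew brace, written multiplicatively. -/
abbrev addGroup : Group B where
  mul := S.add
  one := S.zero
  inv := S.neg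
  mul_assoc := S.add_assoc
  one_mul := S.zero_add
  mul_one := S.add_zero
  inv_mul_cancel := S.neg_add

/-- The homomorphism from a free group to the additive group of a skew brace. -/
def freeGroupLift {k : ℕ} (y : Fin k → B) (w : FreeGroup (Fin k)) : B :=
  letI := S.addGroup
  FreeGroup.lift y w

variable {k : ℕ} (y : Fin k → B)

theorem freeGroupLift_mul (v w : FreeGroup (Fin k)) :
    S.freeGroupLift y (v * w) = S.add (S.freeGroupLift y v) (S.freeGroupLift y w) :=
  letI := S.addGroup
  map_mul (FreeGroup.lift y) v w

theorem freeGroupLift_one : S.freeGroupLift y 1 = S.zero :=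
  letI := S.addGroup
  map_one (FreeGroup.lift y)

theorem freeGroupLift_inv (w : FreeGroup (Fin k)) :
    S.freeGroupLift y w⁻¹ = S.neg (S.freeGroupLift y w) :=
  letI := S.addGroup
  map_inv (FreeGroup.lift y) w

theorem freeGroupLift_of (i : Fin k) : S.freeGroupLift y (FreeGroup.of i) = y i :=
  letI := S.addGroup
  FreeGroup.lift_apply_of

/-- An additive map out of a free group is determined by the images of the generators. -/
theorem eq_freeGroupLift {f : FreeGroup (Fin k) → B}
    (hf : ∀ v w, f (v * w) = S.add (f v) (f w)) (hy : ∀ i, f (FreeGroup.of i) = y i)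
    (w : FreeGroup (Fin k)) : f w = S.freeGroupLift y w := by
  let := S.addGroup
  exact DFunLike.congr_fun
    (FreeGroup.ext_hom (f := MonoidHom.mk' f hf) (g := FreeGroup.lift y)
      fun i => (hy i).trans (FreeGroup.lift_apply_of).symm) w

theorem freeGroupLift_mem {N : Set B} (hN : S.IsAddSubgroup N) (hy : ∀ i, y i ∈ N)
    (w : FreeGroup (Fin k)) : S.freeGroupLift y w ∈ N := by
  induction w using FreeGroup.induction_on with
  | C1 => rw [freeGroupLift_one]; exact hN.1
  | of i => rw [freeGroupLift_of]; exact hy i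
  | inv_of i h => rw [freeGroupLift_inv]; exact hN.2.2 _ h
  | mul v w hv hw => rw [freeGroupLift_mul]; exact hN.2.1 _ hv _ hw

theorem IsHom.map_freeGroupLift {C : Type u} {T : SkewBrace C} {S : SkewBrace B} {f : B → C}
    (hf : IsHom S T f) (y : Fin k → B) (w : FreeGroup (Fin k)) :
    f (S.freeGroupLift y w) = T.freeGroupLift (fun i => f (y i)) w :=
  T.eq_freeGroupLift _ (f := fun w => f (S.freeGroupLift y w))
    (fun v w => by rw [freeGroupLift_mul, hf.1]) (fun i => by rw [freeGroupLift_of]) w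

/-- The elements whose additive conjugation preserves `A`. -/
theorem isAddSubgroup_normalizer (A : Set B) :
    S.IsAddSubgroup {g | ∀ a ∈ A, S.add g (S.add a (S.neg g)) ∈ A ∧
      S.add (S.neg g) (S.add a g) ∈ A} := by
  refine ⟨fun a ha => ?_, fun g hg h hh a ha => ⟨?_, ?_⟩, fun g hg a ha => ?_⟩
  · simpa only [S.neg_zero, S.add_zero, S.zero_add, and_self] using ha
  · simpa only [S.neg_add_rev, S.add_assoc] using (hg _ (hh a ha).1).1
  · simpa only [S.neg_add_rev, S.add_assoc] using (hh _ (hg a ha).2).2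
  · rw [S.neg_neg]
    exact (hg a ha).symm

theorem freeGroupLift_normalizes {A : Set B}
    (hnorm : ∀ i, ∀ a ∈ A, S.add (y i) (S.add a (S.neg (y i))) ∈ A ∧
      S.add (S.neg (y i)) (S.add a (y i)) ∈ A)
    (w : FreeGroup (Fin k)) {a : B} (ha : a ∈ A) :
    S.add (S.freeGroupLift y w) (S.add a (S.neg (S.freeGroupLift y w))) ∈ A ∧
      S.add (S.neg (S.freeGroupLift y w)) (S.add a (S.freeGroupLift y w)) ∈ A :=
  S.freeGroupLift_mem y (S.isAddSubgroup_normalizer A) hnorm w a ha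

theorem isAddSubgroup_freeGroupLift_add {A : Set B} (hA : S.IsAddSubgroup A)
    (hnorm : ∀ i, ∀ a ∈ A, S.add (y i) (S.add a (S.neg (y i))) ∈ A ∧
      S.add (S.neg (y i)) (S.add a (y i)) ∈ A) :
    S.IsAddSubgroup {n | ∃ w, ∃ a ∈ A, n = S.add (S.freeGroupLift y w) a} := by
  refine ⟨⟨1, S.zero, hA.1, ?_⟩, ?_, ?_⟩
  · rw [freeGroupLift_one, S.zero_add]
  · rintro _ ⟨v, a, ha, rfl⟩ _ ⟨w, b, hb, rfl⟩
    refine ⟨v * w, _, hA.2.1 _ (S.freeGroupLift_normalizes y hnorm w ha).2 _ hb, ?_⟩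
    simp only [freeGroupLift_mul, S.add_assoc, S.add_neg_cancel_left]
  · rintro _ ⟨v, a, ha, rfl⟩
    refine ⟨v⁻¹, _, (S.freeGroupLift_normalizes y hnorm v (hA.2.2 _ ha)).1, ?_⟩
    simp only [freeGroupLift_inv, S.neg_add_rev, S.neg_add_cancel_left]

theorem freeGroupLift_mem_of_mem_normalClosure {A : Set B} (hA : S.IsAddSubgroup A)
    (hnorm : ∀ i, ∀ a ∈ A, S.add (y i) (S.add a (S.neg (y i))) ∈ A ∧
      S.add (S.neg (y i)) (S.add a (y i)) ∈ A)
    {R : Set (FreeGroup (Fin k))}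
    (hR : ∀ r ∈ R, S.freeGroupLift y r ∈ A) {w : FreeGroup (Fin k)}
    (hw : w ∈ Subgroup.normalClosure R) : S.freeGroupLift y w ∈ A := by
  let K : Subgroup (FreeGroup (Fin k)) :=
    { carrier := {w | S.freeGroupLift y w ∈ A}
      one_mem' := by
        change S.freeGroupLift y 1 ∈ A
        rw [freeGroupLift_one]
        exact hA.1
      mul_mem' := fun {v w} hv hw => by
        change S.freeGroupLift y (v * w) ∈ A
        rw [freeGroupLift_mul]
        exact hA.2.1 _ hv _ hw
      inv_mem' := fun {v} hv => by
        change S.freeGroupLift y v⁻¹ ∈ A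
        rw [freeGroupLift_inv]
        exact hA.2.2 _ hv }
  have hK : K.Normal := ⟨fun v hv w => by
    change S.freeGroupLift y (w * v * w⁻¹) ∈ A
    rw [freeGroupLift_mul, freeGroupLift_mul, freeGroupLift_inv, S.add_assoc]
    exact (S.freeGroupLift_normalizes y hnorm w hv).1⟩
  exact Subgroup.normalClosure_le_normal (N := K) hR hw

end AddGroup

section Generation

variable {G : Type u} (T : SkewBrace G)

/-- For an additive subgroup `N`, the elements `g ∈ N` such that `λ_g` and its inverse
preserve `N` form a multiplicative subgroup. -/
theorem isMulSubgroup_lamStabilizer {N : Set G} (hN : T.IsAddSubgroup N) :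
    T.IsMulSubgroup
      {g | g ∈ N ∧ ∀ n ∈ N, T.lam g n ∈ N ∧ T.lam (T.inv g) n ∈ N} := by
  refine ⟨⟨hN.1, fun n hn => ?_⟩, ?_, ?_⟩
  · rw [T.inv_eq_of_mul_eq_zero (T.zero_mul _), T.zero_lam]
    exact ⟨hn, hn⟩
  · rintro g ⟨hg, hg'⟩ h ⟨hh, hh'⟩
    refine ⟨?_, fun n hn => ?_⟩
    · rw [T.mul_eq_add_lam]
      exact hN.2.1 _ hg _ (hg' h hh).1
    · rw [T.inv_mul_rev, T.mul_lam, T.mul_lam]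
      exact ⟨(hg' _ (hh' n hn).1).1, (hh' _ (hg' n hn).2).2⟩
  · rintro g ⟨hg, hg'⟩
    refine ⟨?_, fun n hn => ?_⟩
    · rw [T.inv_eq_neg_lam]
      exact hN.2.2 _ (hg' g hg).2
    · rw [T.inv_inv]
      exact (hg' n hn).symm

theorem isAddSubgroup_lam_preimage {N : Set G} (hN : T.IsAddSubgroup N) (g : G) :
    T.IsAddSubgroup {n | T.lam g n ∈ N} := by
  refine ⟨?_, fun a ha b hb => ?_, fun a ha => ?_⟩ <;> simp only [Set.mem_ofPred_eq] at *
  · rw [T.lam_zero]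
    exact hN.1
  · rw [T.lam_add]
    exact hN.2.1 _ ha _ hb
  · rw [T.lam_neg]
    exact hN.2.2 _ ha

variable {B : Type u} {S : SkewBrace B} {φ : G → B}

/-- If a homomorphism is injective on an additive subgroup `N` and some multiplicative
subgroup contained in `N` already maps onto everything, then `N` is a sub-skew brace. -/
theorem isSub_of_mulSubgroup_surjective (hφ : IsHom T S φ) {N P : Set G}
    (hN : T.IsAddSubgroup N) (hker : ∀ n ∈ N, φ n = S.zero → n = T.zero)
    (hP : T.IsMulSubgroup P) (hPN : P ⊆ N) (hsurj : ∀ b, ∃ p ∈ P, φ p = b) : T.IsSub N := by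
  have hNP : N = P := by
    refine Set.Subset.antisymm (fun n hn => ?_) hPN
    obtain ⟨p, hp, hpn⟩ := hsurj (φ n)
    rwa [← hφ.eq_of_ker_trivial hN hker (hPN hp) hn hpn]
  refine ⟨hN.1, hN.2.1, hN.2.2, ?_, ?_⟩
  · rw [hNP]
    exact hP.2.1
  · rw [hNP]
    exact hP.2.2

/-- A multiplicative subgroup containing generators of an ideal and of the quotient by it
is everything. -/
theorem eq_univ_of_mulClosure {Q : Type u} {SQ : SkewBrace Q} {I : Set B} {π : B → Q}
    (hπ : S.IsQuotientBy I SQ π) {P : Set B} (hP : S.IsMulSubgroup P) {X : Set B}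
    (hX : S.mulClosure X = I) (hXP : X ⊆ P) {Y : Set Q} (hY : SQ.mulClosure Y = Set.univ)
    (hYP : Y ⊆ π '' P) (b : B) : b ∈ P := by
  have hb : π b ∈ SQ.mulClosure Y := hY ▸ Set.mem_univ _
  obtain ⟨p, hp, hpb⟩ := SQ.mulClosure_subset (hπ.1.isMulSubgroup_image hP) hYP hb
  have h : S.mul (S.inv p) b ∈ I := by
    rw [← hπ.2.2, Set.mem_ofPred_eq, hπ.1.2, hπ.1.map_inv, hpb, SQ.inv_mul]
  rw [← hX] at h
  have h' := hP.2.1 _ hp _ (S.mulClosure_subset hP hXP h)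
  rwa [S.mul_inv_cancel_left] at h'

end Generation

/-- A surjection from a free skew brace onto `B` that becomes injective modulo a finite subset
of its kernel is a finite presentation. -/
theorem finitelyPresented_of_injective {B F : Type u} {S : SkewBrace B} {SF : SkewBrace F}
    {m : ℕ} {ι : Fin m → F} {θ : F → B} (hF : IsFreeOn SF ι) (hθ : IsHom SF S θ)
    (hsurj : Function.Surjective θ) {R : Set F} (hfin : R.Finite)
    (hR : ∀ r ∈ R, θ r = S.zero)
    (hinj : ∀ (G : Type u) (T : SkewBrace G) (q : F → G) (φ : G → B), IsHom SF T q →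
      Function.Surjective q → IsHom T S φ → (∀ x, φ (q x) = θ x) → (∀ r ∈ R, q r = T.zero) →
      ∀ g, φ g = S.zero → g = T.zero) : S.FinitelyPresented := by
  refine ⟨F, SF, m, ι, θ, hF, hθ, hsurj, hfin.toFinset, ?_⟩
  rw [hfin.coe_toFinset]
  have hle : SF.idealGen R ⊆ {x | θ x = S.zero} := SF.idealGen_subset hθ.isIdeal_ker hR
  refine Set.Subset.antisymm (fun x hx => ?_) hle
  have hK := SF.isIdeal_idealGen R
  obtain ⟨hq, hqs, hqk⟩ := SF.isQuotientBy_quotient hK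
  obtain ⟨φ, hφ, hφq⟩ := SF.exists_quotient_lift hK hθ hle
  have hmem : ∀ x, x ∈ SF.idealGen R ↔ Quotient.mk _ x = (SF.quotient hK).zero := fun x => by
    rw [← Set.ext_iff.mp hqk x, Set.mem_ofPred_eq]
  rw [hmem]
  refine hinj _ _ _ φ hq hqs hφ hφq (fun r hr => (hmem r).mp (SF.subset_idealGen R hr)) _ ?_
  rw [hφq]
  exact hx

section Extension

variable {G B : Type u} {T : SkewBrace G} {S : SkewBrace B} {φ : G → B}

/-- An additive subgroup on which `φ` is injective is generated by any of its subsets whose image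
generates its image. -/
theorem IsHom.subset_addClosure_of_image (hφ : IsHom T S φ) {A : Set G} (hA : T.IsAddSubgroup A)
    (hker : ∀ a ∈ A, φ a = S.zero → a = T.zero) {V : Set G} (hVA : V ⊆ A) {X : Set B}
    (hX : φ '' A ⊆ S.addClosure X) (hXV : X ⊆ φ '' V) : A ⊆ T.addClosure V := by
  intro a ha
  obtain ⟨d, hd, hda⟩ := S.addClosure_subset
    (hφ.isAddSubgroup_image (T.isAddSubgroup_addClosure V))
    (hXV.trans (Set.image_mono (T.subset_addClosure V))) (hX ⟨a, ha, rfl⟩)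
  rwa [← hφ.eq_of_ker_trivial hA hker (T.addClosure_subset hA hVA hd) ha hda]

/-- The injectivity criterion behind the extension theorem: `A` is a copy of the ideal `I` in `G`,
and `y` lifts the generators of a presentation, with relators `R`, of the additive group of the
quotient. -/
theorem IsHom.ker_trivial_of_extension (hφ : IsHom T S φ) {I : Set B} {Q : Type u}
    {SQ : SkewBrace Q} {π : B → Q} (hπ : S.IsQuotientBy I SQ π)
    {A : Set G} (hA : T.IsAddSubgroup A) (hAker : ∀ a ∈ A, φ a = S.zero → a = T.zero)
    (hAI : φ '' A ⊆ I)
    {k : ℕ} {f : FreeGroup (Fin k) → Q} {R : Set (FreeGroup (Fin k))}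
    (hR : {x | f x = SQ.zero} = ↑(Subgroup.normalClosure R))
    {y : Fin k → G} (hy : ∀ w, π (φ (T.freeGroupLift y w)) = f w)
    (hRA : ∀ r ∈ R, T.freeGroupLift y r ∈ A)
    {X : Set B} (hX : S.addClosure X = I) {V : Set G} (hVA : V ⊆ A) (hXV : X ⊆ φ '' V)
    (hconj : ∀ i, ∀ v ∈ V, T.add (y i) (T.add v (T.neg (y i))) ∈ A ∧
      T.add (T.neg (y i)) (T.add v (y i)) ∈ A)
    {N : Set G} (hN : N = {n | ∃ w, ∃ a ∈ A, n = T.add (T.freeGroupLift y w) a})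
    {W : Set G} (hWN : W ⊆ N)
    (hlam : ∀ w ∈ W, ∀ v ∈ V ∪ Set.range y, T.lam w v ∈ N ∧ T.lam (T.inv w) v ∈ N)
    {Y : Set B} (hY : S.mulClosure Y = I) (hYW : Y ⊆ φ '' W)
    {Z : Set Q} (hZ : SQ.mulClosure Z = Set.univ) (hZW : Z ⊆ (fun g => π (φ g)) '' W)
    (hgen : ∀ M, T.IsSub M → A ⊆ M → Set.range y ⊆ M → ∀ g, g ∈ M) (g : G)
    (hg : φ g = S.zero) : g = T.zero := by
  have hAV : A ⊆ T.addClosure V :=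
    hφ.subset_addClosure_of_image hA hAker hVA (hAI.trans hX.superset) hXV
  have hnorm : ∀ i, ∀ a ∈ A, T.add (y i) (T.add a (T.neg (y i))) ∈ A ∧
      T.add (T.neg (y i)) (T.add a (y i)) ∈ A := by
    intro i a ha
    refine T.addClosure_subset (T := {a | T.add (y i) (T.add a (T.neg (y i))) ∈ A ∧
      T.add (T.neg (y i)) (T.add a (y i)) ∈ A}) ⟨?_, ?_, ?_⟩ (hconj i) (hAV ha)
    · simpa only [Set.mem_ofPred_eq, T.zero_add, T.add_neg, T.neg_add, and_self] using hA.1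
    · rintro b ⟨hb, hb'⟩ c ⟨hc, hc'⟩
      have h := hA.2.1 _ hb _ hc
      have h' := hA.2.1 _ hb' _ hc'
      simp only [T.add_assoc, T.neg_add_cancel_left, T.add_neg_cancel_left] at h h'
      simpa only [Set.mem_ofPred_eq, T.add_assoc] using And.intro h h'
    · rintro b ⟨hb, hb'⟩
      have h := hA.2.2 _ hb
      have h' := hA.2.2 _ hb'
      simp only [T.neg_add_rev, T.neg_neg, T.add_assoc] at h h'
      exact ⟨h, h'⟩
  have hNsub : T.IsAddSubgroup N := hN ▸ T.isAddSubgroup_freeGroupLift_add y hA hnorm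
  have hAN : A ⊆ N := fun a ha => by
    rw [hN]
    exact ⟨1, a, ha, by rw [freeGroupLift_one, T.zero_add]⟩
  have hyN : ∀ i, y i ∈ N := fun i => by
    rw [hN]
    exact ⟨FreeGroup.of i, T.zero, hA.1, by rw [freeGroupLift_of, T.add_zero]⟩
  have hNker : ∀ n ∈ N, φ n = S.zero → n = T.zero := by
    intro n hn hn0
    refine hAker n ?_ hn0
    rw [hN] at hn
    obtain ⟨w, a, ha, rfl⟩ := hn
    refine hA.2.1 _ (T.freeGroupLift_mem_of_mem_normalClosure y hA hnorm hRA ?_) _ ha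
    rw [← SetLike.mem_coe, ← hR, Set.mem_ofPred_eq, ← hy w]
    have haI : π (φ a) = SQ.zero := by
      have h := hAI ⟨a, ha, rfl⟩
      rwa [← hπ.2.2] at h
    have h := congrArg π hn0
    rwa [hφ.1, hπ.1.1, haI, SQ.add_zero, hπ.1.map_zero] at h
  have hstable : ∀ g, (∀ v ∈ V ∪ Set.range y, T.lam g v ∈ N) → ∀ n ∈ N, T.lam g n ∈ N := by
    intro g hg n hn
    have hsub := T.isAddSubgroup_lam_preimage hNsub g
    rw [hN] at hn
    obtain ⟨w, a, ha, rfl⟩ := hn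
    refine hsub.2.1 _ (T.freeGroupLift_mem y hsub (fun i => hg _ (Or.inr ⟨i, rfl⟩)) w) _ ?_
    exact T.addClosure_subset hsub (fun v hv => hg v (Or.inl hv)) (hAV ha)
  have hP := T.isMulSubgroup_lamStabilizer hNsub
  have hWP : W ⊆ {g | g ∈ N ∧ ∀ n ∈ N, T.lam g n ∈ N ∧ T.lam (T.inv g) n ∈ N} :=
    fun w hw => ⟨hWN hw, fun n hn => ⟨hstable w (fun v hv => (hlam w hw v hv).1) n hn,
      hstable _ (fun v hv => (hlam w hw v hv).2) n hn⟩⟩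
  have hsurj := eq_univ_of_mulClosure hπ (hφ.isMulSubgroup_image hP) hY
    (hYW.trans (Set.image_mono hWP)) hZ
    (by rw [Set.image_image]; exact hZW.trans (Set.image_mono hWP))
  have hNbrace := T.isSub_of_mulSubgroup_surjective hφ hNsub hNker hP (fun _ h => h.1) hsurj
  exact hNker g (hgen N hNbrace hAN (Set.range_subset_iff.mpr hyN) g) hg

end Extension

end SkewBrace

/-- **Theorem (extension of finite presentations).** Let `I` be an ideal of a skew
brace `B` such that (1) the groups `(I,+)`, `(I,∘)` and `(B/I,∘)` are finitely
generated; (2) the skew braces `I` and `B/I` are finitely presented and the group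
`(B/I,+)` is finitely presented. Then `B` is finitely presented as a skew brace.
(Here the skew brace `I` is represented by any skew brace embedding onto `I`, and the
quotient `B/I` by any surjective homomorphism with kernel `I`.) -/
theorem finitely_presented_of_ideal {B : Type u} (S : SkewBrace B) (I : Set B)
    (hI : S.IsIdeal I)
    -- (1) (I,+) is finitely generated
    (hIadd : ∃ T : Finset B, ↑T ⊆ I ∧ S.addClosure ↑T = I)
    -- (1) (I,∘) is finitely generated
    (hImul : ∃ T : Finset B, ↑T ⊆ I ∧ S.mulClosure ↑T = I)
    -- (1) (B/I,∘) is finitely generated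
    (hQmul : ∀ (Q : Type u) (SQ : SkewBrace Q) (π : B → Q),
      S.IsQuotientBy I SQ π → SQ.MulFG)
    -- (2) the skew brace I is finitely presented
    (hIfp : ∀ (C : Type u) (SC : SkewBrace C) (j : C → B),
      SkewBrace.IsHom SC S j → Function.Injective j → Set.range j = I →
        SC.FinitelyPresented)
    -- (2) the skew brace B/I is finitely presented
    (hQfp : ∀ (Q : Type u) (SQ : SkewBrace Q) (π : B → Q),
      S.IsQuotientBy I SQ π → SQ.FinitelyPresented)
    -- (2) the group (B/I,+) is finitely presented
    (hQaddfp : ∀ (Q : Type u) (SQ : SkewBrace Q) (π : B → Q),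
      S.IsQuotientBy I SQ π → SQ.AddFP) :
    S.FinitelyPresented := by
  let SQ := S.quotient hI
  let π : B → Quotient (S.idealSetoid hI) := Quotient.mk _
  have hπ : S.IsQuotientBy I SQ π := S.isQuotientBy_quotient hI
  have hmemI : ∀ b, b ∈ I ↔ π b = SQ.zero := fun b => by
    rw [← Set.ext_iff.mp hπ.2.2 b, Set.mem_ofPred_eq]
  obtain ⟨X, hXI, hX⟩ := hIadd
  obtain ⟨Y, hYI, hY⟩ := hImul
  obtain ⟨Z, hZ⟩ := hQmul _ SQ π hπ
  obtain ⟨k, f, hf, hfs, RQ, hRQ⟩ := hQaddfp _ SQ π hπ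
  obtain ⟨FI, SFI, n, ιI, θI, hFI, hθI, hθIs, RI, hRI⟩ :=
    hIfp I (S.restrict hI) Subtype.val ⟨fun _ _ => rfl, fun _ _ => rfl⟩ Subtype.val_injective
      Subtype.range_val
  choose σ hσ using hπ.2.1
  let F := SkewBrace.Free.{u} (Fin (n + k))
  let SF : SkewBrace F := SkewBrace.free (Fin (n + k))
  have hF : SF.IsFreeOn SkewBrace.freeOf := SkewBrace.isFreeOn_free _
  obtain ⟨θ, ⟨hθ, hθof⟩, -⟩ := hF B S
    (Fin.append (fun i => (θI (ιI i) : B)) fun i => σ (f (FreeGroup.of i)))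
  obtain ⟨ψ, ⟨hψ, hψof⟩, -⟩ := hFI F SF fun i => SkewBrace.freeOf (Fin.castAdd k i)
  have hθψ : ∀ s, θ (ψ s) = θI s := by
    obtain ⟨g, -, hg⟩ := hFI B S fun i => (θI (ιI i) : B)
    intro s
    have h₁ := hg (θ ∘ ψ) ⟨hθ.comp hψ, fun i => by
      rw [Function.comp, hψof, hθof, Fin.append_left]⟩
    have h₂ := hg (fun s => (θI s : B)) ⟨⟨fun a b => congrArg Subtype.val (hθI.1 a b),
      fun a b => congrArg Subtype.val (hθI.2 a b)⟩, fun _ => rfl⟩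
    exact congrFun (h₁.trans h₂.symm) s
  let y : Fin k → F := fun i => SkewBrace.freeOf (Fin.natAdd n i)
  have hθy : ∀ w, π (θ (SF.freeGroupLift y w)) = f w := fun w => by
    have h := (hπ.1.comp hθ).map_freeGroupLift y w
    refine h.trans (SQ.eq_freeGroupLift _ hf (fun i => ?_) w).symm
    rw [Function.comp, hθof, Fin.append_right, hσ]
  have hcI : ∀ b, ∃ s, b ∈ I → θ (ψ s) = b := fun b => by
    by_cases hb : b ∈ I
    · obtain ⟨s, hs⟩ := hθIs ⟨b, hb⟩
      exact ⟨s, fun _ => by rw [hθψ, hs]⟩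
    · exact ⟨SFI.zero, fun h => absurd h hb⟩
  choose cI hcI using hcI
  have hcN : ∀ b, ∃ w s, θ (SF.add (SF.freeGroupLift y w) (ψ s)) = b := fun b => by
    obtain ⟨w, hw⟩ := hfs (π b)
    refine ⟨w, cI (S.add (S.neg (θ (SF.freeGroupLift y w))) b), ?_⟩
    rw [hθ.1, hcI, S.add_neg_cancel_left]
    rw [hmemI, hπ.1.1, hπ.1.map_neg, hθy, hw, SQ.neg_add]
  choose cw cs hcN using hcN
  let cN : B → F := fun b => SF.add (SF.freeGroupLift y (cw b)) (ψ (cs b))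
  let V : Set F := (fun b => ψ (cI b)) '' ↑X
  let W : Set F := cN '' (↑Y ∪ σ '' ↑Z)
  let U : Set F := Set.image2 SF.lam W (V ∪ Set.range y) ∪
    Set.image2 (fun w v => SF.lam (SF.inv w) v) W (V ∪ Set.range y)
  let U' : Set F :=
    Set.image2 (fun i v => SF.add (y i) (SF.add v (SF.neg (y i)))) Set.univ V ∪
    Set.image2 (fun i v => SF.add (SF.neg (y i)) (SF.add v (y i))) Set.univ V ∪
    SF.freeGroupLift y '' ↑RQ
  have hVI : ∀ v ∈ V, θ v ∈ I := by
    rintro _ ⟨b, hb, rfl⟩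
    rw [hcI b (hXI hb)]
    exact hXI hb
  have hU' : ∀ u ∈ U', θ u ∈ I := by
    rintro _ ((⟨i, -, v, hv, rfl⟩ | ⟨i, -, v, hv, rfl⟩) | ⟨r, hr, rfl⟩)
    · rw [hθ.1, hθ.1, hθ.map_neg, ← S.add_assoc]
      exact hI.2.1 _ _ (hVI v hv)
    · rw [hθ.1, hθ.1, hθ.map_neg]
      exact hI.neg_conj_mem _ (hVI v hv)
    · rw [hmemI, hθy]
      exact hRQ.superset (Subgroup.subset_normalClosure hr)
  let R : Set F := ψ '' ↑RI ∪ (fun u => SF.add u (SF.neg (cN (θ u)))) '' U ∪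
    (fun u => SF.add u (SF.neg (ψ (cI (θ u))))) '' U'
  have hVfin : V.Finite := X.finite_toSet.image _
  have hWfin : W.Finite := (Y.finite_toSet.union (Z.finite_toSet.image _)).image _
  have hVyfin : (V ∪ Set.range y).Finite := hVfin.union (Set.finite_range y)
  have hRfin : R.Finite :=
    ((RI.finite_toSet.image _).union
      (((hWfin.image2 _ hVyfin).union (hWfin.image2 _ hVyfin)).image _)).union
      ((((Set.finite_univ.image2 _ hVfin).union (Set.finite_univ.image2 _ hVfin)).union
        (RQ.finite_toSet.image _)).image _)
  refine SkewBrace.finitelyPresented_of_injective hF hθ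
    (fun b => ⟨cN b, hcN b⟩) hRfin ?_ ?_
  · rintro _ ((⟨r, hr, rfl⟩ | ⟨u, hu, rfl⟩) | ⟨u, hu, rfl⟩)
    · rw [hθψ]
      exact congrArg Subtype.val (hRI.superset (SFI.subset_idealGen _ hr))
    · rw [hθ.1, hθ.map_neg, hcN, S.add_neg]
    · rw [hθ.1, hθ.map_neg, hcI _ (hU' u hu), S.add_neg]
  intro G T q φ hq hqs hφ hφq hqR
  have hqψ : SkewBrace.IsHom SFI T (q ∘ ψ) := hq.comp hψ
  have hqy : ∀ w, q (SF.freeGroupLift y w) = T.freeGroupLift (fun i => q (y i)) w :=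
    fun w => hq.map_freeGroupLift y w
  have hqN : ∀ b, ∃ w, ∃ a ∈ Set.range (q ∘ ψ),
      q (cN b) = T.add (T.freeGroupLift (fun i => q (y i)) w) a := fun b =>
    ⟨cw b, _, ⟨cs b, rfl⟩, by rw [hq.1, hqy]; rfl⟩
  have hqU : ∀ u ∈ U, q u = q (cN (θ u)) := fun u hu => T.eq_of_add_neg_eq_zero <| by
    rw [← hq.map_neg, ← hq.1]
    exact hqR _ (Or.inl (Or.inr ⟨u, hu, rfl⟩))
  have hqU' : ∀ u ∈ U', q u ∈ Set.range (q ∘ ψ) := fun u hu =>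
    ⟨cI (θ u), Eq.symm <| T.eq_of_add_neg_eq_zero <| by
      rw [Function.comp, ← hq.map_neg, ← hq.1]
      exact hqR _ (Or.inr ⟨u, hu, rfl⟩)⟩
  refine hφ.ker_trivial_of_extension hπ (A := Set.range (q ∘ ψ)) ?_ ?_ ?_ hRQ
    (y := fun i => q (y i)) (fun w => by rw [← hqy, hφq, hθy]) ?_ hX (V := q '' V) ?_ ?_ ?_ rfl
    (W := q '' W) ?_ ?_ hY ?_ hZ ?_ ?_
  · rw [← Set.image_univ]
    exact hqψ.isAddSubgroup_image ⟨trivial, fun _ _ _ _ => trivial, fun _ _ => trivial⟩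
  · rintro _ ⟨s, rfl⟩ hs
    rw [Function.comp, hφq, hθψ] at hs
    refine SFI.idealGen_subset hqψ.isIdeal_ker
      (fun r hr => hqR _ (Or.inl (Or.inl ⟨r, hr, rfl⟩))) (hRI.subset ?_)
    exact Subtype.ext hs
  · rintro _ ⟨_, ⟨s, rfl⟩, rfl⟩
    rw [Function.comp, hφq, hθψ]
    exact (θI s).2
  · intro r hr
    rw [← hqy]
    exact hqU' _ (Or.inr ⟨r, hr, rfl⟩)
  · rintro _ ⟨_, ⟨b, hb, rfl⟩, rfl⟩
    exact ⟨cI b, rfl⟩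
  · intro b hb
    exact ⟨_, ⟨_, ⟨b, hb, rfl⟩, rfl⟩, by rw [hφq, hcI b (hXI hb)]⟩
  · rintro i _ ⟨v, hv, rfl⟩
    rw [← hq.map_neg, ← hq.1, ← hq.1, ← hq.1, ← hq.1]
    exact ⟨hqU' _ (Or.inl (Or.inl ⟨i, trivial, v, hv, rfl⟩)),
      hqU' _ (Or.inl (Or.inr ⟨i, trivial, v, hv, rfl⟩))⟩
  · rintro _ ⟨_, ⟨b, -, rfl⟩, rfl⟩
    exact hqN b
  · rintro _ ⟨w, hw, rfl⟩ v' hv'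
    obtain ⟨v, hv, rfl⟩ : ∃ v ∈ V ∪ Set.range y, q v = v' := by
      rcases hv' with ⟨v, hv, rfl⟩ | ⟨i, rfl⟩
      · exact ⟨v, Or.inl hv, rfl⟩
      · exact ⟨y i, Or.inr ⟨i, rfl⟩, rfl⟩
    rw [← hq.map_inv, ← hq.map_lam, ← hq.map_lam, hqU _ (Or.inl ⟨w, hw, v, hv, rfl⟩),
      hqU _ (Or.inr ⟨w, hw, v, hv, rfl⟩)]
    exact ⟨hqN _, hqN _⟩
  · intro b hb
    exact ⟨_, ⟨_, ⟨b, Or.inl hb, rfl⟩, rfl⟩, by rw [hφq, hcN]⟩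
  · intro z hz
    exact ⟨_, ⟨_, ⟨σ z, Or.inr ⟨z, hz, rfl⟩, rfl⟩, rfl⟩, by simp only [hφq, hcN, cN, hσ]⟩
  · intro M hM hAM hyM g
    obtain ⟨x, rfl⟩ := hqs g
    refine SkewBrace.free_induction (hq.isSub_preimage hM) (fun i => ?_) x
    induction i using Fin.addCases with
    | left i => exact hAM ⟨ιI i, congrArg q (hψof i)⟩
    | right i => exact hyM ⟨i, rfl⟩
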